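/- Let S be a finite monoid, A a finite set, F ⊆ SOp(A), and ρ an S-relation presented as a list (r_1, …, r_n) of all tuples occurring in its components together with the signum λ_ρ = (s_1, …, s_n), where s_i = s exactly when r_i is listed as an element of ρ_s (so each s ∈ S appears exactly |ρ_s| times). Then (Γ_F(ρ))_e = { f(r_1, …, r_n) : f ∈ ⟨F⟩_S with sgn(f) = λ_ρ }. -/

import Mathlib

namespace SPreclone

/-- An `S`-operation on `A`: an `(n+1)`-ary operation together with a signum
assigning an element of `S` to each argument. -/
structure SOp (S A : Type*) where
  n : ℕ
  fn : (Fin (n + 1) → A) → A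
  sgn : Fin (n + 1) → S

/-- An `S`-relation on `A`: a family of `(m+1)`-ary relations indexed by `S`. -/
structure SRel (S A : Type*) where
  m : ℕ
  rel : S → Set (Fin (m + 1) → A)

section

variable {S A : Type*} [Monoid S]

/-- `f` S-preserves `ρ`. -/
def SPreserves (f : SOp S A) (ρ : SRel S A) : Prop :=
  ∀ s : S, ∀ r : Fin (f.n + 1) → (Fin (ρ.m + 1) → A),
    (∀ i, r i ∈ ρ.rel (f.sgn i * s)) →
    (fun j => f.fn fun i => r i j) ∈ ρ.rel s

/-- `S`-polymorphisms of a set of `S`-relations. -/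
def SPol (Q : Set (SRel S A)) : Set (SOp S A) := { f | ∀ ρ ∈ Q, SPreserves f ρ }

/-- Invariant `S`-relations of a set of `S`-operations. -/
def SInv (F : Set (SOp S A)) : Set (SRel S A) := { ρ | ∀ f ∈ F, SPreserves f ρ }

/-- The identity operation, with signum `(e)`. -/
def idOp (S A : Type*) [Monoid S] : SOp S A := ⟨0, fun x => x 0, fun _ => 1⟩

/-- Cyclic shift `ζ` of the arguments (and the signa). -/
def cycOp (f : SOp S A) : SOp S A :=
  ⟨f.n, fun x => f.fn fun j => x (j + 1), fun i => f.sgn (i - 1)⟩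

/-- Transposition `τ` of the first two arguments (and their signa). -/
def swapOp (f : SOp S A) : SOp S A :=
  ⟨f.n, fun x => f.fn fun j => x (Equiv.swap 0 1 j), fun i => f.sgn (Equiv.swap 0 1 i)⟩

/-- `∇^s`: adding a fictitious first argument with signum `s`. -/
def nablaOp (s : S) (f : SOp S A) : SOp S A :=
  ⟨f.n + 1, fun x => f.fn fun j => x j.succ, Fin.cases (motive := fun _ => S) s f.sgn⟩

open Classical in
/-- `Δ`: identification of the first two arguments when they have the same signum
(otherwise, and for unary operations, `Δ f := f`). -/
noncomputable def deltaOp (f : SOp S A) : SOp S A :=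
  match f with
  | ⟨0, fn, sgn⟩ => ⟨0, fn, sgn⟩
  | ⟨m + 1, fn, sgn⟩ =>
    if sgn 0 = sgn 1 then
      ⟨m, fun x => fn fun j => x ⟨j.val - 1, by have := j.isLt; omega⟩,
        fun i => sgn i.succ⟩
    else ⟨m + 1, fn, sgn⟩

/-- Composition `(f ∘ g)(x₁,…,x_m,x_{m+1},…,x_{m+n-1}) = f(g(x₁,…,x_m),x_{m+1},…,x_{m+n-1})`,
with signum `(s'₁s₁, …, s'_m s₁, s₂, …, s_n)`. -/
def compOp (f g : SOp S A) : SOp S A :=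
  ⟨g.n + f.n,
   fun x => f.fn fun k => Fin.cases (motive := fun _ => A)
     (g.fn fun i => x ⟨i.val, by have := i.isLt; omega⟩)
     (fun j => x ⟨g.n + 1 + j.val, by have := j.isLt; omega⟩) k,
   fun i =>
     if h : i.val < g.n + 1 then g.sgn ⟨i.val, h⟩ * f.sgn 0
     else f.sgn ⟨i.val - g.n, by have := i.isLt; omega⟩⟩

/-- A set of `S`-operations is an `S`-preclone if it contains the identity and is closed
under `ζ`, `τ`, `∇^s`, `Δ` and composition. -/
def IsSPreclone (F : Set (SOp S A)) : Prop :=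
  idOp S A ∈ F ∧
  (∀ f ∈ F, cycOp f ∈ F) ∧
  (∀ f ∈ F, swapOp f ∈ F) ∧
  (∀ (s : S), ∀ f ∈ F, nablaOp s f ∈ F) ∧
  (∀ f ∈ F, deltaOp f ∈ F) ∧
  (∀ f ∈ F, ∀ g ∈ F, compOp f g ∈ F)

/-- The `S`-preclone generated by `F` (the least `S`-preclone containing `F`). -/
def SSg (F : Set (SOp S A)) : Set (SOp S A) := ⋂₀ { G | IsSPreclone G ∧ F ⊆ G }

/-- `δ^S := (Δ_A)_{s ∈ S}`. -/
def deltaS (S A : Type*) : SRel S A := ⟨1, fun _ => { a | a 0 = a 1 }⟩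

/-- Componentwise cyclic shift of coordinates. -/
def cycRel (ρ : SRel S A) : SRel S A :=
  ⟨ρ.m, fun s => { b | (fun i => b (i - 1)) ∈ ρ.rel s }⟩

/-- Componentwise transposition of the first two coordinates. -/
def swapRel (ρ : SRel S A) : SRel S A :=
  ⟨ρ.m, fun s => { b | (fun i => b (Equiv.swap 0 1 i)) ∈ ρ.rel s }⟩

/-- Componentwise deletion of the first coordinate (identity on unary relations). -/
def prRel (ρ : SRel S A) : SRel S A :=
  match ρ with
  | ⟨0, r⟩ => ⟨0, r⟩
  | ⟨m + 1, r⟩ => ⟨m, fun s => { b | ∃ a ∈ r s, b = fun j => a j.succ }⟩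

/-- Componentwise Cartesian product. -/
def prodRel (ρ ρ' : SRel S A) : SRel S A :=
  ⟨ρ.m + ρ'.m + 1, fun s =>
    { c | (fun i : Fin (ρ.m + 1) => c ⟨i.val, by have := i.isLt; omega⟩) ∈ ρ.rel s ∧
          (fun i : Fin (ρ'.m + 1) => c ⟨ρ.m + 1 + i.val, by have := i.isLt; omega⟩) ∈ ρ'.rel s }⟩

/-- Componentwise intersection; empty if the arities differ. -/
def interRel (ρ ρ' : SRel S A) : SRel S A :=
  if h : ρ.m = ρ'.m then
    ⟨ρ.m, fun s => { a | a ∈ ρ.rel s ∧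
        (fun i : Fin (ρ'.m + 1) => a (Fin.cast (by omega) i)) ∈ ρ'.rel s }⟩
  else ⟨ρ.m, fun _ => ∅⟩

/-- Index translation `μ_v(ρ) := (ρ_{sv})_{s ∈ S}`. -/
def muRel (v : S) (ρ : SRel S A) : SRel S A := ⟨ρ.m, fun s => ρ.rel (s * v)⟩

/-- `v`-self-intersection `(⊓^v ρ)_s := ⋂ { ρ_{s'} ∣ s'v = s }`
(an empty intersection being the full relation). -/
def selfInterRel (v : S) (ρ : SRel S A) : SRel S A :=
  ⟨ρ.m, fun s => { a | ∀ s' : S, s' * v = s → a ∈ ρ.rel s' }⟩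

/-- A set of `S`-relations is an `S`-relational clone if it contains `δ^S` and is
closed under `ζ`, `τ`, `pr`, `×`, `∧`, `μ_v` and `⊓^v`. -/
def IsSRelClone (Q : Set (SRel S A)) : Prop :=
  deltaS S A ∈ Q ∧
  (∀ ρ ∈ Q, cycRel ρ ∈ Q) ∧
  (∀ ρ ∈ Q, swapRel ρ ∈ Q) ∧
  (∀ ρ ∈ Q, prRel ρ ∈ Q) ∧
  (∀ ρ ∈ Q, ∀ ρ' ∈ Q, prodRel ρ ρ' ∈ Q) ∧
  (∀ ρ ∈ Q, ∀ ρ' ∈ Q, interRel ρ ρ' ∈ Q) ∧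
  (∀ (v : S), ∀ ρ ∈ Q, muRel v ρ ∈ Q) ∧
  (∀ (v : S), ∀ ρ ∈ Q, selfInterRel v ρ ∈ Q)

/-- The `S`-relational clone generated by `Q`. -/
def SRg (Q : Set (SRel S A)) : Set (SRel S A) := ⋂₀ { R | IsSRelClone R ∧ Q ⊆ R }

/-- `Γ_F(ρ)`: the least `S`-relation of the same arity containing `ρ` and invariant
for `F` (defined as the intersection of all such). -/
def Gamma (F : Set (SOp S A)) (ρ : SRel S A) : SRel S A :=
  ⟨ρ.m, fun s => ⋂ g ∈ { g : S → Set (Fin (ρ.m + 1) → A) |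
      (⟨ρ.m, g⟩ : SRel S A) ∈ SInv F ∧ ∀ t, ρ.rel t ⊆ g t }, g s⟩

/-- Trivial `S`-operations (trivial projections): projections whose essential
argument has signum `e`. -/
def SJ (S A : Type*) [Monoid S] : Set (SOp S A) :=
  { f | ∃ i : Fin (f.n + 1), f.sgn i = 1 ∧ ∀ x, f.fn x = x i }

/-- A diagonal relation: empty, or defined by an equivalence relation on the coordinates. -/
def IsDiagonal {A : Type*} {m : ℕ} (σ : Set (Fin m → A)) : Prop :=
  σ = ∅ ∨ ∃ ε : Fin m → Fin m → Prop, Equivalence ε ∧ σ = { a | ∀ i j, ε i j → a i = a j }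

/-- `S`-diagonal `S`-relations. -/
def SD (S A : Type*) [Monoid S] : Set (SRel S A) :=
  { ρ | (∀ s, IsDiagonal (ρ.rel s)) ∧
      ∀ s t : S, ({ x | ∃ u, x = u * s } : Set S) ⊆ { x | ∃ u, x = u * t } →
        ρ.rel s ⊆ ρ.rel t }

/-- Projection of an `S`-relation to the rows `z 0, …, z t` (componentwise). -/
def prMulti {t : ℕ} (ρ : SRel S A) (z : Fin (t + 1) → Fin (ρ.m + 1)) : SRel S A :=
  ⟨t, fun s => { b | ∃ a ∈ ρ.rel s, b = fun j => a (z j) }⟩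

/-- One step of the inductive construction of `Γ_F(ρ)`:
`R s ∪ { f(r₁,…,r_n) ∣ f ∈ F, r_j ∈ R (sgn(f)_j * s) }`. -/
def gammaStep (F : Set (SOp S A)) {m : ℕ}
    (R : S → Set (Fin (m + 1) → A)) : S → Set (Fin (m + 1) → A) :=
  fun s => R s ∪ { b | ∃ f ∈ F, ∃ r : Fin (f.n + 1) → (Fin (m + 1) → A),
    (∀ j, r j ∈ R (f.sgn j * s)) ∧ b = fun z => f.fn fun j => r j z }

/-- `χ` is (a presentation of) the `S`-relation `χ^λ`: its rows are enumerated by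
*all* tuples of `A^n` via `e`, and its `s`-component consists exactly of the columns
`κ_i` with `λ i = s`. -/
def IsChi {n : ℕ} (lam : Fin n → S) (χ : SRel S A) : Prop :=
  ∃ e : Fin (χ.m + 1) ≃ (Fin n → A),
    ∀ s, χ.rel s = { c | ∃ i, lam i = s ∧ c = fun z => e z i }

/-- `γ_Q(ρ)`: the least `S`-relation of the same arity containing `ρ` and belonging
to the `S`-relational clone generated by `Q` (defined as the intersection of all such). -/
def gammaQ (Q : Set (SRel S A)) (ρ : SRel S A) : SRel S A :=
  ⟨ρ.m, fun s => ⋂ g ∈ { g : S → Set (Fin (ρ.m + 1) → A) |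
      (⟨ρ.m, g⟩ : SRel S A) ∈ SRg Q ∧ ∀ t, ρ.rel t ⊆ g t }, g s⟩

/-- `π`-dual of an `S`-operation. -/
def opPi (π : Equiv.Perm A) (f : SOp S A) : SOp S A :=
  ⟨f.n, fun x => π (f.fn fun i => π.symm (x i)), f.sgn⟩

/-- `π`-dual of an `S`-relation. -/
def relPi (π : Equiv.Perm A) (ρ : SRel S A) : SRel S A :=
  ⟨ρ.m, fun s => { b | ∃ a ∈ ρ.rel s, b = fun i => π (a i) }⟩

/-- `h`-dual of an `S`-operation (only the signum changes). -/
def opH (h : S ≃* S) (f : SOp S A) : SOp S A :=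
  ⟨f.n, f.fn, fun i => h (f.sgn i)⟩

/-- `h`-dual of an `S`-relation: `ρ^h := (ρ_{h⁻¹(s)})_{s ∈ S}`. -/
def relH (h : S ≃* S) (ρ : SRel S A) : SRel S A :=
  ⟨ρ.m, fun s => ρ.rel (h.symm s)⟩

end

/-- An ordinary (unsigned) operation on `A`. -/
structure UOp (A : Type*) where
  n : ℕ
  fn : (Fin (n + 1) → A) → A

/-- An ordinary (unsigned) relation on `A`. -/
structure URel (A : Type*) where
  m : ℕ
  rel : Set (Fin (m + 1) → A)

/-- Ordinary preservation of a relation by an operation. -/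
def UPreserves {A : Type*} (f : UOp A) (σ : URel A) : Prop :=
  ∀ r : Fin (f.n + 1) → (Fin (σ.m + 1) → A),
    (∀ i, r i ∈ σ.rel) → (fun j => f.fn fun i => r i j) ∈ σ.rel

/-- Polymorphisms of a set of ordinary relations. -/
def UPol {A : Type*} (R : Set (URel A)) : Set (UOp A) := { f | ∀ σ ∈ R, UPreserves f σ }

/-- A clone: contains all projections and is closed under composition. -/
def IsClone {A : Type*} (C : Set (UOp A)) : Prop :=
  (∀ (n : ℕ) (i : Fin (n + 1)), (⟨n, fun x => x i⟩ : UOp A) ∈ C) ∧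
  (∀ f ∈ C, ∀ (m : ℕ) (g : Fin (f.n + 1) → ((Fin (m + 1) → A) → A)),
    (∀ i, (⟨m, g i⟩ : UOp A) ∈ C) → (⟨m, fun x => f.fn fun i => g i x⟩ : UOp A) ∈ C)

/-- The clone generated by a set of operations. -/
def CloneGen {A : Type*} (G : Set (UOp A)) : Set (UOp A) := ⋂₀ { C | IsClone C ∧ G ⊆ C }

theorem isSPreclone_SSg {S A : Type*} [Monoid S] (F : Set (SOp S A)) : IsSPreclone (SSg F) := by
  refine ⟨?_, ?_, ?_, ?_, ?_, ?_⟩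
  · exact fun G hG => hG.1.1
  · exact fun f hf G hG => hG.1.2.1 f (hf G hG)
  · exact fun f hf G hG => hG.1.2.2.1 f (hf G hG)
  · exact fun s f hf G hG => hG.1.2.2.2.1 s f (hf G hG)
  · exact fun f hf G hG => hG.1.2.2.2.2.1 f (hf G hG)
  · exact fun f hf g hg G hG => hG.1.2.2.2.2.2 f (hf G hG) g (hg G hG)

theorem subset_SSg {S A : Type*} [Monoid S] (F : Set (SOp S A)) : F ⊆ SSg F :=
  fun _ hf _ hG => hG.2 hf

/-- The `S`-polymorphisms of an `S`-relation form an `S`-preclone. -/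
theorem isSPreclone_setOf_SPreserves {S A : Type*} [Monoid S] (ρ : SRel S A) :
    IsSPreclone { f : SOp S A | SPreserves f ρ } := by
  refine ⟨?_, ?_, ?_, ?_, ?_, ?_⟩
  · intro s r hr
    have h0 : r 0 ∈ ρ.rel (1 * s) := hr 0
    rw [one_mul] at h0
    exact h0
  · intro f hf s r hr
    change Fin (f.n + 1) → _ at r
    refine hf s (fun j => r (j + 1)) fun j => ?_
    have hj : r (j + 1) ∈ ρ.rel (f.sgn (j + 1 - 1) * s) :=
      hr (show Fin (f.n + 1) from j + 1)
    rwa [add_sub_cancel_right] at hj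
  · intro f hf s r hr
    change Fin (f.n + 1) → _ at r
    refine hf s (fun j => r (Equiv.swap 0 1 j)) fun j => ?_
    have hj : r (Equiv.swap 0 1 j) ∈ ρ.rel (f.sgn (Equiv.swap 0 1 (Equiv.swap 0 1 j)) * s) :=
      hr (Equiv.swap 0 1 j)
    rwa [Equiv.swap_apply_self] at hj
  · intro v f hf s r hr
    exact hf s (fun j => r j.succ) fun j => hr j.succ
  · rintro ⟨_ | m, fn, sgn⟩ hf
    · exact hf
    · by_cases h : sgn 0 = sgn 1
      · simp only [deltaOp, h, if_true, Set.mem_ofPred_eq]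
        intro s r hr
        change Fin (m + 1) → _ at r
        refine hf s (fun j : Fin (m + 2) => r ⟨j.val - 1, by have := j.isLt; omega⟩) fun j => ?_
        refine Fin.cases ?_ (fun i => hr i) j
        have h0 := hr 0
        simp only [Fin.succ_zero_eq_one, ← h] at h0
        exact h0
      · simpa only [deltaOp, h, if_false] using hf
  · intro f hf g hg s r hr
    have key := hf s (fun k => Fin.cases (motive := fun _ => Fin (ρ.m + 1) → A)
      (fun z => g.fn fun i => r ⟨i.val, by have := i.isLt; simp only [compOp]; omega⟩ z)
      (fun j => r ⟨g.n + 1 + j.val, by have := j.isLt; simp only [compOp]; omega⟩) k) ?_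
    · refine (congrArg (· ∈ ρ.rel s) (funext fun z => ?_)).mpr key
      change f.fn _ = f.fn _
      congr 1
      funext k
      refine Fin.cases rfl (fun j => rfl) k
    · intro k
      refine Fin.cases ?_ (fun j => ?_) k
      · refine hg _ _ fun i => ?_
        have := hr ⟨i.val, by have := i.isLt; simp only [compOp]; omega⟩
        simpa only [compOp, i.isLt, dite_true, mul_assoc] using this
      · have := hr ⟨g.n + 1 + j.val, by have := j.isLt; simp only [compOp]; omega⟩
        have e : (⟨g.n + 1 + j.val - g.n, by have := j.isLt; omega⟩ : Fin (f.n + 1)) = j.succ :=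
          Fin.ext (by simp; omega)
        have h' : ¬ g.n + 1 + j.val < g.n + 1 := by omega
        simp only [compOp, h', dite_false, e] at this
        exact this

theorem SPreserves_of_mem_SSg {S A : Type*} [Monoid S] {F : Set (SOp S A)} {ρ : SRel S A}
    (hρ : ρ ∈ SInv F) {f : SOp S A} (hf : f ∈ SSg F) : SPreserves f ρ :=
  hf _ ⟨isSPreclone_setOf_SPreserves ρ, hρ⟩

/-- Rearrangement of the arguments of an `S`-operation along a permutation. -/
def permOp {S A : Type*} (f : SOp S A) (π : Equiv.Perm (Fin (f.n + 1))) : SOp S A :=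
  ⟨f.n, fun x => f.fn fun j => x (π j), fun i => f.sgn (π.symm i)⟩

/-- `S`-preclones are closed under permutation of arguments. -/
theorem IsSPreclone.permOp_mem {S A : Type*} [Monoid S] {G : Set (SOp S A)}
    (hG : IsSPreclone G) {f : SOp S A} (hf : f ∈ G) (π : Equiv.Perm (Fin (f.n + 1))) :
    permOp f π ∈ G := by
  obtain ⟨n, fn, sgn⟩ := f
  rcases n with _ | n
  · obtain rfl : π = 1 := Equiv.ext fun i => Subsingleton.elim (α := Fin 1) _ _
    exact hf
  have htop := Equiv.Perm.closure_cycle_adjacent_swap (σ := finRotate (n + 2))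
    isCycle_finRotate support_finRotate 0
  rw [finRotate_apply, zero_add] at htop
  have hπ : π ∈ Submonoid.closure {finRotate (n + 2), Equiv.swap 0 1} := by
    rw [← Subgroup.closure_toSubmonoid_of_finite, htop]
    trivial
  change (⟨n + 1, fun x => fn fun j => x (π j), fun i => sgn (π.symm i)⟩ : SOp S A) ∈ G
  clear htop
  induction hπ using Submonoid.closure_induction_left with
  | one => exact hf
  | mul_left a ha b hb ih =>
    rcases ha with rfl | rfl
    · convert hG.2.1 _ ih using 1
      simp only [cycOp, SOp.mk.injEq, heq_eq_eq, true_and]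
      refine ⟨by funext x; simp, ?_⟩
      funext i
      have : (finRotate (n + 2)).symm i = i - 1 := by
        rw [Equiv.symm_apply_eq, finRotate_apply, sub_add_cancel]
      change sgn (b.symm ((finRotate (n + 2)).symm i)) = _
      rw [this]
    · exact hG.2.2.1 _ ih

/-- The `S`-relation consisting of the tuples `f(r_{φ 1}, …, r_{φ k})`, `f ∈ G`, whose
`s`-component collects those with `sgn(f)_j * s = λ_{φ j}` for all `j`. -/
def orbit {S A ι M : Type*} [Monoid S] (G : Set (SOp S A)) (r : ι → M → A) (lam : ι → S)
    (s : S) : Set (M → A) :=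
  { b | ∃ f ∈ G, ∃ φ : Fin (f.n + 1) → ι,
      (∀ j, f.sgn j * s = lam (φ j)) ∧ b = fun z => f.fn fun j => r (φ j) z }

theorem IsSPreclone.mem_orbit {S A ι M : Type*} [Monoid S] {G : Set (SOp S A)}
    (hG : IsSPreclone G) (r : ι → M → A) (lam : ι → S) (i : ι) :
    r i ∈ orbit G r lam (lam i) :=
  ⟨idOp S A, hG.1, fun _ => i, fun _ => one_mul _, rfl⟩

/-- The orbit relation is closed under the members of the `S`-preclone. -/
theorem IsSPreclone.apply_mem_orbit {S A ι M : Type*} [Monoid S] {G : Set (SOp S A)}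
    (hG : IsSPreclone G) (r : ι → M → A) (lam : ι → S) (s : S) {h : SOp S A} (hh : h ∈ G)
    (x : Fin (h.n + 1) → M → A) (hx : ∀ j, x j ∈ orbit G r lam (h.sgn j * s)) :
    (fun z => h.fn fun j => x j z) ∈ orbit G r lam s := by
  classical
  induction hc : (Finset.univ.filter fun j => ¬ ∃ i, lam i = h.sgn j * s ∧ x j = r i).card
    using Nat.strong_induction_on generalizing h with
  | _ c ih =>
  subst hc
  by_cases hgood : ∀ j, ∃ i, lam i = h.sgn j * s ∧ x j = r i
  · choose φ hφ hxφ using hgood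
    exact ⟨h, hh, φ, fun j => (hφ j).symm, by simp only [hxφ]⟩
  push Not at hgood
  obtain ⟨j₀, hj₀⟩ := hgood
  -- Move a slot not filled by a generator to the front and expand it.
  obtain ⟨h', hh', x', hx', hbad', hcard, heq⟩ : ∃ h' ∈ G, ∃ x' : Fin (h'.n + 1) → M → A,
      (∀ j, x' j ∈ orbit G r lam (h'.sgn j * s)) ∧
      (¬ ∃ i, lam i = h'.sgn 0 * s ∧ x' 0 = r i) ∧
      (Finset.univ.filter fun j => ¬ ∃ i, lam i = h'.sgn j * s ∧ x' j = r i).card =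
        (Finset.univ.filter fun j => ¬ ∃ i, lam i = h.sgn j * s ∧ x j = r i).card ∧
      (fun z => h.fn fun j => x j z) = fun z => h'.fn fun j => x' j z := by
    refine ⟨permOp h (Equiv.swap 0 j₀), hG.permOp_mem hh _, fun j => x (Equiv.swap 0 j₀ j),
      fun j => hx _, ?_, ?_, ?_⟩
    · rintro ⟨i, h1, h2⟩
      have e : Equiv.swap 0 j₀ 0 = j₀ := Equiv.swap_apply_left _ _
      change lam i = h.sgn (Equiv.swap 0 j₀ 0) * s at h1
      change x (Equiv.swap 0 j₀ 0) = r i at h2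
      rw [e] at h1 h2
      exact hj₀ i h1 h2
    · refine Finset.card_equiv (Equiv.swap 0 j₀) fun j => ?_
      simp only [Finset.mem_filter, Finset.mem_univ, true_and]
      exact Iff.rfl
    · simp [permOp]
  rw [heq]
  rw [← hcard] at ih
  obtain ⟨g, hg, φ, hφ, hx0⟩ := hx' 0
  set y : Fin ((compOp h' g).n + 1) → M → A := fun i =>
    if hi : i.val < g.n + 1 then r (φ ⟨i.val, hi⟩)
    else x' ⟨i.val - g.n, by have := i.isLt; simp only [compOp] at this; omega⟩ with hy
  have hval : (fun z => h'.fn fun j => x' j z) =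
      fun z => (compOp h' g).fn fun j => y j z := by
    funext z
    simp only [compOp]
    congr 1
    funext k
    refine Fin.cases ?_ (fun j => ?_) k
    · simp only [hx0, Fin.cases_zero]
      congr 1
      funext i
      simp only [hy, i.isLt, dite_true]
    · have e : (⟨g.n + 1 + j.val - g.n, by have := j.isLt; omega⟩ : Fin (h'.n + 1)) = j.succ :=
        Fin.ext (by simp; omega)
      have hn : ¬ g.n + 1 + j.val < g.n + 1 := by omega
      simp only [hy, hn, dite_false, e, Fin.cases_succ]
  rw [hval]
  have hlow : ∀ i : Fin ((compOp h' g).n + 1), ∀ hi : i.val < g.n + 1,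
      lam (φ ⟨i.val, hi⟩) = (compOp h' g).sgn i * s ∧ y i = r (φ ⟨i.val, hi⟩) := by
    intro i hi
    simp only [hy, compOp, hi, dite_true, and_true, mul_assoc, hφ]
  have hhigh : ∀ i : Fin ((compOp h' g).n + 1), ∀ hi : ¬ i.val < g.n + 1,
      ∃ k : Fin (h'.n + 1), k.val = i.val - g.n ∧
        (compOp h' g).sgn i = h'.sgn k ∧ y i = x' k := by
    intro i hi
    refine ⟨⟨i.val - g.n, by have := i.isLt; simp only [compOp] at this; omega⟩, rfl, ?_, ?_⟩ <;>
    simp only [hy, compOp, hi, dite_false]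
  refine ih _ ?_ (hG.2.2.2.2.2 h' hh' g hg) y ?_ rfl
  · refine lt_of_le_of_lt (b := ((Finset.univ.filter
      fun j => ¬ ∃ i, lam i = h'.sgn j * s ∧ x' j = r i).erase 0).card) ?_
      (Finset.card_erase_lt_of_mem (by simpa using hbad'))
    have hbig : ∀ i ∈ Finset.univ.filter
        (fun j => ¬ ∃ i, lam i = (compOp h' g).sgn j * s ∧ y j = r i), ¬ i.val < g.n + 1 :=
      fun i hi hlt => (Finset.mem_filter.1 hi).2 ⟨_, hlow i hlt⟩
    refine Finset.card_le_card_of_injOn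
      (fun i => ⟨i.val - g.n, by have := i.isLt; simp only [compOp] at this; omega⟩) ?_ ?_
    · intro i hi
      have hi1 := hbig i hi
      obtain ⟨k, hk, hs, hyk⟩ := hhigh i hi1
      have hi2 := (Finset.mem_filter.1 hi).2
      rw [hs, hyk] at hi2
      have e : (⟨i.val - g.n, by have := i.isLt; simp only [compOp] at this; omega⟩ :
        Fin (h'.n + 1)) = k := Fin.ext hk.symm
      simp only [e, Finset.mem_coe, Finset.mem_erase, Finset.mem_filter, Finset.mem_univ,
        true_and]
      refine ⟨fun h0 => ?_, hi2⟩
      rw [h0] at hk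
      simp only [Fin.val_zero] at hk
      omega
    · intro i hi i' hi' hii
      have h1 := hbig i hi
      have h2 := hbig i' hi'
      have := congrArg Fin.val hii
      exact Fin.ext (by simp only at this; omega)
  · intro i
    by_cases hi : i.val < g.n + 1
    · obtain ⟨h1, h2⟩ := hlow i hi
      rw [← h1, h2]
      exact hG.mem_orbit r lam _
    · obtain ⟨k, -, h1, h2⟩ := hhigh i hi
      rw [h1, h2]
      exact hx' k

/-- Arguments fed with the same variable (and hence having the same signum) can be identified. -/
theorem IsSPreclone.exists_injective {S A ι : Type*} [Monoid S] {G : Set (SOp S A)}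
    (hG : IsSPreclone G) {lam : ι → S} {f : SOp S A} (hf : f ∈ G) (φ : Fin (f.n + 1) → ι)
    (hφ : ∀ j, f.sgn j = lam (φ j)) :
    ∃ g ∈ G, ∃ ψ : Fin (g.n + 1) → ι, Function.Injective ψ ∧ (∀ j, g.sgn j = lam (ψ j)) ∧
      ∀ x : ι → A, (g.fn fun j => x (ψ j)) = f.fn fun j => x (φ j) := by
  obtain ⟨n, hn⟩ : ∃ n, f.n = n := ⟨_, rfl⟩
  induction n generalizing f with
  | zero =>
    refine ⟨f, hf, φ, fun a b _ => ?_, hφ, fun _ => rfl⟩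
    have := a.isLt
    have := b.isLt
    exact Fin.ext (by omega)
  | succ n ih =>
    by_cases hinj : Function.Injective φ
    · exact ⟨f, hf, φ, hinj, hφ, fun _ => rfl⟩
    obtain ⟨a, b, hab, hne⟩ := Function.not_injective_iff.1 hinj
    obtain ⟨m, fn, sgn⟩ := f
    obtain rfl : m = n + 1 := hn
    change Fin (n + 2) → ι at φ
    change Fin (n + 2) at a
    change Fin (n + 2) at b
    obtain ⟨π, hπa, hπb⟩ : ∃ π : Equiv.Perm (Fin (n + 2)), π 0 = a ∧ π 1 = b := by
      refine ⟨Equiv.swap a (Equiv.swap 1 b 0) * Equiv.swap 1 b, ?_, ?_⟩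
      · simp
      · have h1 : b ≠ Equiv.swap 1 b 0 := by
          intro h
          have := congrArg (Equiv.swap 1 b) h
          simp at this
        simp [Equiv.swap_apply_of_ne_of_ne hne.symm h1]
    have hmem := hG.2.2.2.2.1 _ (hG.permOp_mem hf π.symm)
    have hsgn : sgn (π 0) = sgn (π 1) := by
      rw [hπa, hπb]
      exact ((hφ a).trans (congrArg lam hab)).trans (hφ b).symm
    simp only [permOp, deltaOp, Equiv.symm_symm, hsgn, if_true] at hmem
    obtain ⟨g, hg, ψ, hψ, hs, hval⟩ := ih hmem (fun i => φ (π i.succ)) (fun j => hφ _) rfl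
    refine ⟨g, hg, ψ, hψ, hs, fun x => (hval x).trans ?_⟩
    change fn _ = fn _
    congr 1
    funext j
    obtain ⟨k, rfl⟩ := π.surjective j
    simp only [Equiv.symm_apply_apply]
    congr 1
    refine Fin.cases ?_ (fun i => rfl) k
    change φ (π 1) = φ (π 0)
    rw [hπa, hπb, hab]

/-- Missing variables can be added as fictitious arguments. -/
theorem IsSPreclone.exists_bijective {S A ι : Type*} [Monoid S] [Finite ι] {G : Set (SOp S A)}
    (hG : IsSPreclone G) {lam : ι → S} {f : SOp S A} (hf : f ∈ G) (φ : Fin (f.n + 1) → ι)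
    (hinj : Function.Injective φ) (hφ : ∀ j, f.sgn j = lam (φ j)) :
    ∃ g ∈ G, ∃ ψ : Fin (g.n + 1) → ι, Function.Bijective ψ ∧ (∀ j, g.sgn j = lam (ψ j)) ∧
      ∀ x : ι → A, (g.fn fun j => x (ψ j)) = f.fn fun j => x (φ j) := by
  obtain ⟨k, hk⟩ : ∃ k, Nat.card ι - (f.n + 1) = k := ⟨_, rfl⟩
  induction k generalizing f with
  | zero =>
    refine ⟨f, hf, φ, hinj.bijective_of_nat_card_le ?_, hφ, fun _ => rfl⟩
    simp only [Nat.card_eq_fintype_card (α := Fin _), Fintype.card_fin]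
    omega
  | succ k ih =>
    by_cases hsurj : Function.Surjective φ
    · exact ⟨f, hf, φ, ⟨hinj, hsurj⟩, hφ, fun _ => rfl⟩
    simp only [Function.Surjective, not_forall, not_exists] at hsurj
    obtain ⟨i, hi⟩ := hsurj
    obtain ⟨g, hg, ψ, hψ, hs, hval⟩ := ih (hG.2.2.2.1 (lam i) f hf) (Fin.cons i φ)
      (Fin.cons_injective_iff.2 ⟨fun ⟨j, hj⟩ => hi j hj, hinj⟩)
      (fun j => Fin.cases rfl hφ j) (by simp only [nablaOp]; omega)
    exact ⟨g, hg, ψ, hψ, hs, hval⟩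

/-- For `S`-preclones, the `e`-component of the orbit is attained by operations of signum `λ`. -/
theorem IsSPreclone.exists_of_mem_orbit_one {S A M : Type*} [Monoid S] {G : Set (SOp S A)}
    (hG : IsSPreclone G) {n : ℕ} {r : Fin n → M → A} {lam : Fin n → S} {b : M → A}
    (hb : b ∈ orbit G r lam 1) :
    ∃ f ∈ G, ∃ hn : f.n + 1 = n, (∀ i, f.sgn i = lam (Fin.cast hn i)) ∧
      b = fun z => f.fn fun i => r (Fin.cast hn i) z := by
  obtain ⟨f, hf, φ, hφ, rfl⟩ := hb
  obtain ⟨f₁, hf₁, φ₁, hinj, hφ₁, hval₁⟩ :=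
    hG.exists_injective (lam := lam) hf φ fun j => by rw [← hφ, mul_one]
  obtain ⟨g, hg, ψ, hψ, hs, hval⟩ := hG.exists_bijective hf₁ φ₁ hinj hφ₁
  have hn : g.n + 1 = n := by simpa using Fintype.card_of_bijective hψ
  subst hn
  refine ⟨permOp g (Equiv.ofBijective ψ hψ), hG.permOp_mem hg _, rfl, fun i => ?_, ?_⟩
  · obtain ⟨j, rfl⟩ := (Equiv.ofBijective ψ hψ).surjective i
    simp only [permOp, Equiv.symm_apply_apply]
    exact hs j
  · funext z
    exact (hval₁ fun i => r i z).symm.trans (hval fun i => r i z).symm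

/-- If `ρ` is presented by the list of tuples `rr : Fin nn → A^m` with signum
`lam : Fin nn → S` (each tuple of `ρ_s` listed exactly once with signum `s`), then
`(Γ_F(ρ))_e = { f(r₁,…,r_n) ∣ f ∈ ⟨F⟩_S, sgn f = λ_ρ }`. -/
theorem Gamma_e_eq_orbit {S A : Type*} [Monoid S] [Fintype S] [Fintype A]
    (F : Set (SOp S A)) (ρ : SRel S A) (nn : ℕ)
    (rr : Fin nn → (Fin (ρ.m + 1) → A)) (lam : Fin nn → S)
    (hlist : ∀ s, ρ.rel s = { c | ∃ i, lam i = s ∧ c = rr i })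
    (hinj : ∀ i j, lam i = lam j → rr i = rr j → i = j) :
    (Gamma F ρ).rel 1 =
      { b | ∃ f ∈ SSg F, ∃ hn : f.n + 1 = nn,
          (∀ i, f.sgn i = lam (Fin.cast hn i)) ∧
          b = fun z => f.fn fun i => rr (Fin.cast hn i) z } := by
  have hG := isSPreclone_SSg F
  apply Set.Subset.antisymm
  · intro b hb
    refine hG.exists_of_mem_orbit_one (r := rr) (lam := lam) ?_
    refine Set.mem_iInter₂.1 hb (orbit (SSg F) rr lam)
      ⟨fun f hf s r hr => hG.apply_mem_orbit rr lam s (subset_SSg F hf) r hr, fun t c hc => ?_⟩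
    rw [hlist] at hc
    obtain ⟨i, rfl, rfl⟩ := hc
    exact hG.mem_orbit rr lam i
  · rintro b ⟨f, hf, hn, hs, rfl⟩
    refine Set.mem_iInter₂.2 fun g ⟨hg, hρg⟩ => ?_
    refine SPreserves_of_mem_SSg hg hf 1 (fun i => rr (Fin.cast hn i)) fun i => hρg _ ?_
    rw [hlist, mul_one]
    exact ⟨_, (hs i).symm, rfl⟩

end SPreclone
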